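/- arXiv:1510.03389 — 3 statements merged into one kernel-verified Lean document; each statement's English description precedes it below -/
import Mathlib

section
/- Let n, p be positive integers, let P_f be an n×n real symmetric positive semidefinite matrix (the forecast error covariance), let R be a p×p real symmetric positive definite matrix (the observation error covariance), and let H be a p×n real matrix (the linear observation operator). For an arbitrary gain matrix K (n×p), define the analysis error covariance P_a(K) = (I − K H) P_f (I − K H)ᵀ + K R Kᵀ. Then the Kalman gain K* = P_f Hᵀ (H P_f Hᵀ + R)⁻¹ minimizes the trace of the analysis error covariance: for every n×p real matrix K, trace(P_a(K*)) ≤ trace(P_a(K)). -/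
open Matrix

/-- The analysis error covariance for an arbitrary gain matrix `K`:
`P_a(K) = (I − K H) P_f (I − K H)ᵀ + K R Kᵀ`. -/
def analysisCov {n p : ℕ} (Pf : Matrix (Fin n) (Fin n) ℝ)
    (R : Matrix (Fin p) (Fin p) ℝ) (H : Matrix (Fin p) (Fin n) ℝ)
    (K : Matrix (Fin n) (Fin p) ℝ) : Matrix (Fin n) (Fin n) ℝ :=
  (1 - K * H) * Pf * (1 - K * H)ᵀ + K * R * Kᵀ

/-- Completing the square: if `G S = P_f Hᵀ` with `S = H P_f Hᵀ + R`, then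
`P_a(K) = P_f − G S Gᵀ + (K − G) S (K − G)ᵀ`. -/
theorem analysisCov_eq_sub_add {n p : ℕ} {Pf : Matrix (Fin n) (Fin n) ℝ}
    {R : Matrix (Fin p) (Fin p) ℝ} {H : Matrix (Fin p) (Fin n) ℝ}
    {G : Matrix (Fin n) (Fin p) ℝ} (hPf : Pf.IsSymm) (hR : R.IsSymm)
    (hG : G * (H * Pf * Hᵀ + R) = Pf * Hᵀ) (K : Matrix (Fin n) (Fin p) ℝ) :
    analysisCov Pf R H K =
      Pf - G * (H * Pf * Hᵀ + R) * Gᵀ + (K - G) * (H * Pf * Hᵀ + R) * (K - G)ᵀ := by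
  have hS : (H * Pf * Hᵀ + R)ᵀ = H * Pf * Hᵀ + R := by
    simp [transpose_mul, hPf.eq, hR.eq, Matrix.mul_assoc]
  have hG' : (H * Pf * Hᵀ + R) * Gᵀ = H * Pf := by
    simpa only [transpose_mul, hS, hPf.eq, transpose_transpose] using congrArg transpose hG
  have hK : analysisCov Pf R H K =
      Pf - K * (H * Pf) - Pf * Hᵀ * Kᵀ + K * (H * Pf * Hᵀ + R) * Kᵀ := by
    simp only [analysisCov, transpose_sub, transpose_one, transpose_mul, Matrix.sub_mul,
      Matrix.mul_sub, Matrix.add_mul, Matrix.mul_add, Matrix.one_mul, Matrix.mul_one,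
      Matrix.mul_assoc]
    abel
  rw [hK]
  generalize H * Pf * Hᵀ + R = S at hG hG' ⊢
  rw [← hG', ← hG]
  simp only [transpose_sub, Matrix.sub_mul, Matrix.mul_sub, Matrix.mul_assoc]
  abel

/-- The Kalman gain `K* = P_f Hᵀ (H P_f Hᵀ + R)⁻¹` minimizes the trace of the
analysis error covariance over all gain matrices `K`. -/
theorem kalman_gain_minimizes_trace_of_analysis_covariance
    (n p : ℕ) (hn : 0 < n) (hp : 0 < p)
    (Pf : Matrix (Fin n) (Fin n) ℝ) (hPf : Pf.PosSemidef)
    (R : Matrix (Fin p) (Fin p) ℝ) (hR : R.PosDef)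
    (H : Matrix (Fin p) (Fin n) ℝ) :
    ∀ K : Matrix (Fin n) (Fin p) ℝ,
      (analysisCov Pf R H (Pf * Hᵀ * (H * Pf * Hᵀ + R)⁻¹)).trace ≤
        (analysisCov Pf R H K).trace := by
  intro K
  have hPf' : Pf.IsSymm := isHermitian_iff_isSymm.mp hPf.isHermitian
  have hR' : R.IsSymm := isHermitian_iff_isSymm.mp hR.isHermitian
  have hS : (H * Pf * Hᵀ + R).PosDef := by
    simpa only [conjTranspose_eq_transpose_of_trivial] using
      PosDef.posSemidef_add (hPf.mul_mul_conjTranspose_same H) hR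
  have hG : Pf * Hᵀ * (H * Pf * Hᵀ + R)⁻¹ * (H * Pf * Hᵀ + R) = Pf * Hᵀ :=
    nonsing_inv_mul_cancel_right _ _ ((isUnit_iff_isUnit_det _).mp hS.isUnit)
  generalize Pf * Hᵀ * (H * Pf * Hᵀ + R)⁻¹ = G at hG ⊢
  have htrace : 0 ≤ ((K - G) * (H * Pf * Hᵀ + R) * (K - G)ᵀ).trace := by
    simpa only [conjTranspose_eq_transpose_of_trivial] using
      (hS.posSemidef.mul_mul_conjTranspose_same (K - G)).trace_nonneg
  rw [analysisCov_eq_sub_add hPf' hR' hG G, analysisCov_eq_sub_add hPf' hR' hG K, sub_self,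
    Matrix.zero_mul, Matrix.zero_mul, add_zero, trace_add]
  exact le_add_of_nonneg_right htrace
end

section
/- Let n, p be positive integers, let B be an n×n real symmetric positive definite matrix (the background error covariance), let R be a p×p real symmetric positive definite matrix (the observation error covariance), let H be a p×n real matrix (the linear observation operator), let x_b ∈ ℝⁿ (the background state) and y ∈ ℝᵖ (the observation vector). Then the 3D-Var cost function J(x) = (x − x_b)ᵀ B⁻¹ (x − x_b) + (y − H x)ᵀ R⁻¹ (y − H x) attains a unique global minimum over x ∈ ℝⁿ, and the minimizer is the optimal-interpolation analysis state x_a = x_b + B Hᵀ (H B Hᵀ + R)⁻¹ (y − H x_b). In particular the variational (3D-Var) analysis coincides with the optimal interpolation analysis. -/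
open Matrix

/-- The 3D-Var cost function
`J(x) = (x − x_b)ᵀ B⁻¹ (x − x_b) + (y − H x)ᵀ R⁻¹ (y − H x)`. -/
noncomputable def threeDVarCost {n p : ℕ} (B : Matrix (Fin n) (Fin n) ℝ)
    (R : Matrix (Fin p) (Fin p) ℝ) (H : Matrix (Fin p) (Fin n) ℝ)
    (xb : Fin n → ℝ) (y : Fin p → ℝ) (x : Fin n → ℝ) : ℝ :=
  (x - xb) ⬝ᵥ B⁻¹.mulVec (x - xb) +
    (y - H.mulVec x) ⬝ᵥ R⁻¹.mulVec (y - H.mulVec x)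

/-- The optimal interpolation analysis state
`x_a = x_b + B Hᵀ (H B Hᵀ + R)⁻¹ (y − H x_b)`. -/
noncomputable def oiAnalysis {n p : ℕ} (B : Matrix (Fin n) (Fin n) ℝ)
    (R : Matrix (Fin p) (Fin p) ℝ) (H : Matrix (Fin p) (Fin n) ℝ)
    (xb : Fin n → ℝ) (y : Fin p → ℝ) : Fin n → ℝ :=
  xb + (B * Hᵀ * (H * B * Hᵀ + R)⁻¹).mulVec (y - H.mulVec xb)

/-- Expansion of the quadratic form of a symmetric matrix at a sum. -/
theorem Matrix.IsSymm.dotProduct_mulVec_add {ι : Type*} [Fintype ι] {A : Matrix ι ι ℝ}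
    (hA : A.IsSymm) (u v : ι → ℝ) :
    (u + v) ⬝ᵥ A *ᵥ (u + v) = u ⬝ᵥ A *ᵥ u + 2 * (v ⬝ᵥ A *ᵥ u) + v ⬝ᵥ A *ᵥ v := by
  have h : u ⬝ᵥ A *ᵥ v = v ⬝ᵥ A *ᵥ u := by
    rw [dotProduct_mulVec, ← mulVec_transpose, hA.eq, dotProduct_comm]
  rw [mulVec_add, dotProduct_add, add_dotProduct, add_dotProduct, h]
  ring

/-- The innovation at the optimal interpolation analysis is
`y - H x_a = R (H B Hᵀ + R)⁻¹ (y - H x_b)`. -/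
theorem sub_mulVec_oiAnalysis {n p : ℕ} {B : Matrix (Fin n) (Fin n) ℝ}
    {R : Matrix (Fin p) (Fin p) ℝ} {H : Matrix (Fin p) (Fin n) ℝ}
    (hS : IsUnit (H * B * Hᵀ + R).det) (xb : Fin n → ℝ) (y : Fin p → ℝ) :
    y - H *ᵥ oiAnalysis B R H xb y = R *ᵥ (H * B * Hᵀ + R)⁻¹ *ᵥ (y - H *ᵥ xb) := by
  have h : (H * B * Hᵀ) *ᵥ (H * B * Hᵀ + R)⁻¹ *ᵥ (y - H *ᵥ xb) +
      R *ᵥ (H * B * Hᵀ + R)⁻¹ *ᵥ (y - H *ᵥ xb) = y - H *ᵥ xb := by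
    rw [← add_mulVec, mulVec_mulVec, mul_nonsing_inv _ hS, one_mulVec]
  rw [oiAnalysis, mulVec_add, ← sub_sub, sub_eq_iff_eq_add']
  refine h.symm.trans ?_
  simp only [mulVec_mulVec, Matrix.mul_assoc]

/-- The 3D-Var cost function exceeds its value at the optimal interpolation analysis by a
quadratic form in the displacement. -/
theorem threeDVarCost_oiAnalysis_add {n p : ℕ} {B : Matrix (Fin n) (Fin n) ℝ} (hB : B.PosDef)
    {R : Matrix (Fin p) (Fin p) ℝ} (hR : R.PosDef) (H : Matrix (Fin p) (Fin n) ℝ)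
    (xb : Fin n → ℝ) (y : Fin p → ℝ) (v : Fin n → ℝ) :
    threeDVarCost B R H xb y (oiAnalysis B R H xb y + v) =
      threeDVarCost B R H xb y (oiAnalysis B R H xb y) +
        (v ⬝ᵥ B⁻¹ *ᵥ v + (H *ᵥ v) ⬝ᵥ R⁻¹ *ᵥ (H *ᵥ v)) := by
  have hS : (H * B * Hᵀ + R).PosDef := by
    simpa using PosDef.posSemidef_add (hB.posSemidef.mul_mul_conjTranspose_same H) hR
  have hBdet : IsUnit B.det := (isUnit_iff_isUnit_det _).1 hB.isUnit
  have hRdet : IsUnit R.det := (isUnit_iff_isUnit_det _).1 hR.isUnit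
  have hres := sub_mulVec_oiAnalysis ((isUnit_iff_isUnit_det _).1 hS.isUnit) xb y
  set w := (H * B * Hᵀ + R)⁻¹ *ᵥ (y - H *ᵥ xb) with hw
  have hinc : oiAnalysis B R H xb y - xb = B *ᵥ Hᵀ *ᵥ w := by
    simp only [oiAnalysis, add_sub_cancel_left, hw, mulVec_mulVec, Matrix.mul_assoc]
  have hBsymm : B⁻¹.IsSymm := by simpa [IsSymm, IsHermitian] using hB.inv.isHermitian
  have hRsymm : R⁻¹.IsSymm := by simpa [IsSymm, IsHermitian] using hR.inv.isHermitian
  have hx : oiAnalysis B R H xb y + v - xb = B *ᵥ Hᵀ *ᵥ w + v := by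
    rw [add_sub_right_comm, hinc]
  have hy : y - H *ᵥ (oiAnalysis B R H xb y + v) = R *ᵥ w + -(H *ᵥ v) := by
    rw [mulVec_add, ← sub_sub, hres, sub_eq_add_neg]
  have hBw : B⁻¹ *ᵥ B *ᵥ Hᵀ *ᵥ w = Hᵀ *ᵥ w := by
    rw [mulVec_mulVec, nonsing_inv_mul _ hBdet, one_mulVec]
  have hRw : R⁻¹ *ᵥ R *ᵥ w = w := by
    rw [mulVec_mulVec, nonsing_inv_mul _ hRdet, one_mulVec]
  have hadj : v ⬝ᵥ Hᵀ *ᵥ w = (H *ᵥ v) ⬝ᵥ w := by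
    rw [dotProduct_mulVec, vecMul_transpose]
  rw [threeDVarCost, threeDVarCost, hx, hy, hinc, hres, hBsymm.dotProduct_mulVec_add,
    hRsymm.dotProduct_mulVec_add, hBw, hRw, hadj]
  simp only [mulVec_neg, neg_dotProduct, dotProduct_neg, neg_neg]
  ring

/-- The 3D-Var cost function attains a unique global minimum, and the minimizer
is the optimal interpolation analysis state: `J(x_a) < J(x)` for every `x ≠ x_a`,
where `x_a = x_b + B Hᵀ (H B Hᵀ + R)⁻¹ (y − H x_b)`. -/
theorem threeDVar_unique_minimizer_is_oi_analysis
    (n p : ℕ) (hn : 0 < n) (hp : 0 < p)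
    (B : Matrix (Fin n) (Fin n) ℝ) (hB : B.PosDef)
    (R : Matrix (Fin p) (Fin p) ℝ) (hR : R.PosDef)
    (H : Matrix (Fin p) (Fin n) ℝ)
    (xb : Fin n → ℝ) (y : Fin p → ℝ) :
    (∀ x : Fin n → ℝ,
        threeDVarCost B R H xb y (oiAnalysis B R H xb y) ≤ threeDVarCost B R H xb y x) ∧
      (∀ x : Fin n → ℝ, x ≠ oiAnalysis B R H xb y →
        threeDVarCost B R H xb y (oiAnalysis B R H xb y) < threeDVarCost B R H xb y x) := by
  have hlt : ∀ x : Fin n → ℝ, x ≠ oiAnalysis B R H xb y →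
      threeDVarCost B R H xb y (oiAnalysis B R H xb y) < threeDVarCost B R H xb y x := by
    intro x hx
    have hexp := threeDVarCost_oiAnalysis_add hB hR H xb y (x - oiAnalysis B R H xb y)
    rw [add_sub_cancel] at hexp
    have hpos := hB.inv.dotProduct_mulVec_pos (sub_ne_zero.2 hx)
    have hnonneg := hR.inv.posSemidef.dotProduct_mulVec_nonneg
      (H *ᵥ (x - oiAnalysis B R H xb y))
    rw [star_trivial] at hpos hnonneg
    linarith
  refine ⟨fun x => ?_, hlt⟩
  rcases eq_or_ne x (oiAnalysis B R H xb y) with rfl | hx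
  · exact le_rfl
  · exact (hlt x hx).le
end

section
/- Let X and Y be real n×m matrices (the first and last m columns of a snapshot matrix), and let X = U Σ Vᵀ be a compact singular value decomposition, where U is n×r with orthonormal columns (UᵀU = I), V is m×r with orthonormal columns (VᵀV = I), and Σ is an r×r invertible diagonal matrix. Define the DMD operator A = Y V Σ⁻¹ Uᵀ (i.e., A = Y X⁺ with X⁺ the Moore–Penrose pseudoinverse) and the reduced matrix Ã = Uᵀ Y V Σ⁻¹. If w ∈ ℝʳ (or ℂʳ) is an eigenvector of à with eigenvalue λ ≠ 0, then the exact DMD mode φ = (1/λ) Y V Σ⁻¹ w satisfies A φ = λ φ; that is, every nonzero eigenvalue of the reduced matrix à is an eigenvalue of the full DMD operator A, with eigenvector φ. -/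
open Matrix

/-- Exact DMD modes: given a compact SVD `X = U Σ Vᵀ` (with `UᵀU = I`, `VᵀV = I`,
`Σ` an invertible diagonal matrix), the full DMD operator `A = Y V Σ⁻¹ Uᵀ = Y X⁺`
and the reduced matrix `Ã = Uᵀ Y V Σ⁻¹`, every eigenvector `w` of `Ã` with
nonzero eigenvalue `λ` yields an exact DMD mode `φ = (1/λ) Y V Σ⁻¹ w` which is an
eigenvector of `A` with the same eigenvalue: `A φ = λ φ` and `φ ≠ 0`. -/
theorem dmd_exact_mode_is_eigenvector
    (n m r : ℕ)
    (X Y : Matrix (Fin n) (Fin m) ℝ)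
    (U : Matrix (Fin n) (Fin r) ℝ)
    (S : Matrix (Fin r) (Fin r) ℝ)
    (V : Matrix (Fin m) (Fin r) ℝ)
    (d : Fin r → ℝ)
    (hSVD : X = U * S * Vᵀ)
    (hU : Uᵀ * U = 1)
    (hV : Vᵀ * V = 1)
    (hSdiag : S = Matrix.diagonal d)
    (hSinv : IsUnit S.det)
    (w : Fin r → ℝ) (lam : ℝ)
    (hw : w ≠ 0) (hlam : lam ≠ 0)
    (heig : (Uᵀ * Y * V * S⁻¹).mulVec w = lam • w) :
    (Y * V * S⁻¹ * Uᵀ).mulVec ((1 / lam) • (Y * V * S⁻¹).mulVec w) =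
        lam • ((1 / lam) • (Y * V * S⁻¹).mulVec w) ∧
      (1 / lam) • (Y * V * S⁻¹).mulVec w ≠ 0 := by
  have heig' : Uᵀ *ᵥ ((Y * V * S⁻¹) *ᵥ w) = lam • w := by
    rw [Matrix.mulVec_mulVec, ← heig]
    simp only [Matrix.mul_assoc]
  refine ⟨?_, fun h => ?_⟩
  · rw [← Matrix.mulVec_mulVec, Matrix.mulVec_smul, heig', smul_smul,
      one_div_mul_cancel hlam, one_smul, smul_smul, mul_one_div_cancel hlam, one_smul]
  · have hzero : (Y * V * S⁻¹) *ᵥ w = 0 :=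
      (smul_eq_zero.mp h).resolve_left (one_div_ne_zero hlam)
    rw [hzero, Matrix.mulVec_zero] at heig'
    exact smul_ne_zero hlam hw heig'.symm
end
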